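/- arXiv:1904.00898 — 3 statements merged into one kernel-verified Lean document; each statement's English description precedes it below -/
import Mathlib

section
/- Let E be a real normed vector space, Γ ⊆ E a convex set, m ≥ 2 an integer, and f : Γ → ℝ a continuous function. Then the following are equivalent: (i) for all points t⁰, t¹, …, t^m ∈ Γ one has Σ_{l=1}^m (f(t^l) − f(t⁰)) ≤ ‖Σ_{l=1}^m (t^l − t⁰)‖; (ii) f is concave on Γ and 1-Lipschitz continuous on Γ (i.e. |f(t) − f(t')| ≤ ‖t − t'‖ for all t, t' ∈ Γ). -/
open Finset

/-- A continuous midpoint-concave function on `[0, 1]` that vanishes at both endpoints is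
nonnegative. -/
lemma nonneg_of_midpoint_concave_unitInterval {g : ℝ → ℝ}
    (hg : ContinuousOn g (Set.Icc 0 1)) (h0 : g 0 = 0) (h1 : g 1 = 0)
    (hmid : ∀ x ∈ Set.Icc (0 : ℝ) 1, ∀ y ∈ Set.Icc (0 : ℝ) 1,
      g x + g y ≤ 2 * g ((x + y) / 2)) :
    ∀ x ∈ Set.Icc (0 : ℝ) 1, 0 ≤ g x := by
  obtain ⟨c, hc, hmin⟩ := isCompact_Icc.exists_isMinOn (Set.nonempty_Icc.2 zero_le_one) hg
  have hmin' : ∀ x ∈ Set.Icc (0 : ℝ) 1, g c ≤ g x := fun x hx => hmin hx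
  intro x hx
  refine le_trans ?_ (hmin' x hx)
  rcases le_total c (1 / 2) with h | h
  · have hmem : 2 * c ∈ Set.Icc (0 : ℝ) 1 := ⟨by linarith [hc.1], by linarith⟩
    have key := hmid 0 (by simp) (2 * c) hmem
    rw [show (0 + 2 * c) / 2 = c by ring] at key
    linarith [hmin' _ hmem]
  · have hmem : 2 * c - 1 ∈ Set.Icc (0 : ℝ) 1 := ⟨by linarith, by linarith [hc.2]⟩
    have key := hmid 1 (by simp) (2 * c - 1) hmem
    rw [show (1 + (2 * c - 1)) / 2 = c by ring] at key
    linarith [hmin' _ hmem]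

/-- A continuous midpoint-concave function on a convex set is concave. -/
lemma ContinuousOn.concaveOn_of_midpoint {E : Type*} [NormedAddCommGroup E] [NormedSpace ℝ E]
    {s : Set E} {f : E → ℝ} (hf : ContinuousOn f s) (hs : Convex ℝ s)
    (hmid : ∀ x ∈ s, ∀ y ∈ s, f x + f y ≤ 2 * f ((1 / 2 : ℝ) • (x + y))) :
    ConcaveOn ℝ s f := by
  refine ⟨hs, fun x hx y hy a b ha hb hab => ?_⟩
  have hmem : ∀ r ∈ Set.Icc (0 : ℝ) 1, r • x + (1 - r) • y ∈ s := fun r hr =>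
    hs hx hy hr.1 (sub_nonneg.2 hr.2) (by ring)
  have key := nonneg_of_midpoint_concave_unitInterval
    (g := fun r => f (r • x + (1 - r) • y) - (r * f x + (1 - r) * f y)) ?_ (by simp) (by simp)
    ?_ a ⟨ha, by linarith⟩
  · obtain rfl : b = 1 - a := by linarith
    simpa using key
  · exact (hf.comp (by fun_prop) hmem).sub (by fun_prop)
  · intro p hp q hq
    have h := hmid _ (hmem p hp) _ (hmem q hq)
    rw [show (1 / 2 : ℝ) • (p • x + (1 - p) • y + (q • x + (1 - q) • y)) =
      ((p + q) / 2) • x + (1 - (p + q) / 2) • y by module] at h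
    linarith

/-- Proposition 2: for `Γ ⊆ E` convex, `m ≥ 2` and `f : Γ → ℝ` continuous, the constraint
family `∑_{l=1}^m (f(t^l) − f(t⁰)) ≤ ‖∑_{l=1}^m (t^l − t⁰)‖` (for all `t⁰, …, t^m ∈ Γ`)
holds if and only if `f` is concave on `Γ` and 1-Lipschitz continuous on `Γ`. -/
theorem constraint_family_iff_concave_lipschitz
    {E : Type*} [NormedAddCommGroup E] [NormedSpace ℝ E]
    (Γ : Set E) (hΓ : Convex ℝ Γ) (m : ℕ) (hm : 2 ≤ m) (f : E → ℝ)
    (hf : ContinuousOn f Γ) :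
    (∀ t0 ∈ Γ, ∀ t : Fin m → E, (∀ l, t l ∈ Γ) →
        ∑ l : Fin m, (f (t l) - f t0) ≤ ‖∑ l : Fin m, (t l - t0)‖) ↔
      (ConcaveOn ℝ Γ f ∧ ∀ t ∈ Γ, ∀ t' ∈ Γ, |f t - f t'| ≤ ‖t - t'‖) := by
  have hm0 : (0 : ℝ) < m := by exact_mod_cast (by omega : 0 < m)
  constructor
  · intro H
    constructor
    · refine hf.concaveOn_of_midpoint hΓ fun x hx y hy => ?_
      obtain ⟨n, rfl⟩ := Nat.exists_eq_add_of_le' hm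
      set z := (1 / 2 : ℝ) • (x + y) with hz
      have hzΓ : z ∈ Γ := by
        rw [hz, smul_add]
        exact hΓ hx hy (by norm_num) (by norm_num) (by norm_num)
      have h := H z hzΓ (Fin.cons x (Fin.cons y fun _ => z))
        (Fin.cases hx (Fin.cases hy fun _ => hzΓ))
      have hsum : x - z + (y - z) = 0 := by rw [hz]; module
      simp only [Fin.sum_univ_succ, Fin.cons_zero, Fin.cons_succ, sub_self, sum_const_zero,
        add_zero, hsum, norm_zero] at h
      linarith
    · have hle : ∀ t ∈ Γ, ∀ t' ∈ Γ, f t - f t' ≤ ‖t - t'‖ := fun t ht t' ht' => by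
        have h := H t' ht' (fun _ => t) fun _ => ht
        simp only [sum_const, card_univ, Fintype.card_fin, ← Nat.cast_smul_eq_nsmul ℝ,
          norm_smul, smul_eq_mul, RCLike.norm_natCast] at h
        exact le_of_mul_le_mul_left h hm0
      exact fun t ht t' ht' => abs_sub_le_iff.2
        ⟨hle t ht t' ht', norm_sub_rev t t' ▸ hle t' ht' t ht⟩
  · rintro ⟨hc, hL⟩ t0 ht0 t ht
    have hw : ∑ _l : Fin m, (m : ℝ)⁻¹ = 1 := by simp [hm0.ne']
    have hmem : ∑ l, (m : ℝ)⁻¹ • t l ∈ Γ :=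
      hΓ.sum_mem (fun _ _ => by positivity) hw fun l _ => ht l
    have hJ := hc.le_map_sum (fun _ _ => by positivity) hw fun l _ => ht l
    have hLip := (le_abs_self _).trans (hL _ hmem t0 ht0)
    have hsum : ∑ l, (t l - t0) = (m : ℝ) • (∑ l, (m : ℝ)⁻¹ • t l - t0) := by
      rw [← smul_sum, smul_sub, smul_inv_smul₀ hm0.ne', sum_sub_distrib]
      simp [Nat.cast_smul_eq_nsmul]
    rw [hsum, norm_smul, RCLike.norm_natCast]
    calc ∑ l, (f (t l) - f t0) = m * (∑ l, (m : ℝ)⁻¹ • f (t l) - f t0) := by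
          rw [← smul_sum, smul_eq_mul, mul_sub, mul_inv_cancel_left₀ hm0.ne', sum_sub_distrib]
          simp
      _ ≤ m * ‖∑ l, (m : ℝ)⁻¹ • t l - t0‖ := by gcongr; linarith
end

section
/- Let E be a real normed vector space, Γ ⊆ E a convex set, m ≥ 1 an integer, and f : Γ → ℝ a function that is concave on Γ and 1-Lipschitz on Γ. Then for all points t⁰, t¹, …, t^m ∈ Γ one has Σ_{l=1}^m (f(t^l) − f(t⁰)) ≤ ‖Σ_{l=1}^m (t^l − t⁰)‖. -/
open Finset

/-- The forward direction of Proposition 2: if `Γ` is convex and `f : Γ → ℝ` is concave on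
`Γ` and 1-Lipschitz on `Γ`, then `f` satisfies the constraint family
`∑_{l=1}^m (f(t^l) − f(t⁰)) ≤ ‖∑_{l=1}^m (t^l − t⁰)‖` for all points `t⁰, t¹, …, t^m ∈ Γ`. -/
theorem concave_lipschitz_implies_constraint_family
    {E : Type*} [NormedAddCommGroup E] [NormedSpace ℝ E]
    (Γ : Set E) (hΓ : Convex ℝ Γ) (m : ℕ) (hm : 1 ≤ m) (f : E → ℝ)
    (hconc : ConcaveOn ℝ Γ f)
    (hlip : ∀ t ∈ Γ, ∀ t' ∈ Γ, |f t - f t'| ≤ ‖t - t'‖) :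
    ∀ t0 ∈ Γ, ∀ t : Fin m → E, (∀ l, t l ∈ Γ) →
      ∑ l : Fin m, (f (t l) - f t0) ≤ ‖∑ l : Fin m, (t l - t0)‖ := by
  intro t0 ht0 t ht
  have hm' : (0 : ℝ) < m := by exact_mod_cast hm
  have hw : ∑ _l : Fin m, (m : ℝ)⁻¹ = 1 := by simp [hm'.ne']
  have hmem : ∑ l, (m : ℝ)⁻¹ • t l ∈ Γ :=
    hΓ.sum_mem (fun _ _ => by positivity) hw fun l _ => ht l
  have hjensen : ∑ l, (m : ℝ)⁻¹ • f (t l) ≤ f (∑ l, (m : ℝ)⁻¹ • t l) :=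
    hconc.le_map_sum (fun _ _ => by positivity) hw fun l _ => ht l
  have hle := (le_abs_self _).trans (hlip _ hmem t0 ht0)
  simp only [← Finset.smul_sum] at hjensen hle
  calc ∑ l, (f (t l) - f t0)
      = m * ((m : ℝ)⁻¹ • ∑ l, f (t l) - f t0) := by
        simp [Finset.sum_sub_distrib, mul_sub, hm'.ne']
    _ ≤ m * ‖(m : ℝ)⁻¹ • ∑ l, t l - t0‖ := by gcongr; linarith
    _ = ‖(m : ℝ) • ((m : ℝ)⁻¹ • ∑ l, t l - t0)‖ := by
        rw [norm_smul, Real.norm_of_nonneg hm'.le]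
    _ = ‖∑ l, (t l - t0)‖ := by
        rw [smul_sub, smul_inv_smul₀ hm'.ne', Finset.sum_sub_distrib]
        simp [Nat.cast_smul_eq_nsmul]
end

section
/- Let a < c ≤ d < b be real numbers and let f : [a,b] → ℝ be concave on [a,b]. Suppose f is affine on [a,c] with slope s₁ satisfying |s₁| ≤ 1, and affine on [d,b] with slope s₂ satisfying |s₂| ≤ 1. Then f is 1-Lipschitz on [a,b], i.e. |f(x) − f(y)| ≤ |x − y| for all x, y ∈ [a,b]. -/
/-- An upper bound on the slope of a concave function over `[x, y]` persists over `[y, z]`. -/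
theorem ConcaveOn.sub_le_mul_sub_of_left {S : Set ℝ} {f : ℝ → ℝ} (hf : ConcaveOn ℝ S f)
    {x y z s : ℝ} (hx : x ∈ S) (hz : z ∈ S) (hxy : x < y) (hyz : y ≤ z)
    (h : f y - f x ≤ s * (y - x)) : f z - f y ≤ s * (z - y) := by
  rcases hyz.eq_or_lt with rfl | hyz
  · simp
  · rw [← div_le_iff₀ (sub_pos.2 hyz)]
    exact (hf.slope_anti_adjacent hx hz hxy hyz).trans ((div_le_iff₀ (sub_pos.2 hxy)).2 h)

/-- A lower bound on the slope of a concave function over `[y, z]` persists over `[x, y]`. -/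
theorem ConcaveOn.mul_sub_le_sub_of_right {S : Set ℝ} {f : ℝ → ℝ} (hf : ConcaveOn ℝ S f)
    {x y z s : ℝ} (hx : x ∈ S) (hz : z ∈ S) (hxy : x ≤ y) (hyz : y < z)
    (h : s * (z - y) ≤ f z - f y) : s * (y - x) ≤ f y - f x := by
  rcases hxy.eq_or_lt with rfl | hxy
  · simp
  · rw [← le_div_iff₀ (sub_pos.2 hxy)]
    exact ((le_div_iff₀ (sub_pos.2 hyz)).2 h).trans (hf.slope_anti_adjacent hx hz hxy hyz)

/-- The slope of an initial affine piece bounds all slopes of a concave function from above. -/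
theorem ConcaveOn.sub_le_of_affine_left {a b c s : ℝ} {f : ℝ → ℝ}
    (hf : ConcaveOn ℝ (Set.Icc a b) f) (hac : a < c) (hcb : c ≤ b)
    (haff : ∀ x ∈ Set.Icc a c, f x = f a + s * (x - a))
    {x y : ℝ} (hax : a ≤ x) (hxy : x ≤ y) (hyb : y ≤ b) : f y - f x ≤ s * (y - x) := by
  have hc := haff c ⟨hac.le, le_rfl⟩
  have key : ∀ z, c ≤ z → z ≤ b → f z - f c ≤ s * (z - c) := fun z hcz hzb =>
    hf.sub_le_mul_sub_of_left ⟨le_rfl, hac.le.trans hcb⟩ ⟨hac.le.trans hcz, hzb⟩ hac hcz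
      (by linarith)
  rcases le_or_gt x c with hxc | hcx
  · have hx := haff x ⟨hax, hxc⟩
    rcases le_total y c with hyc | hcy
    · have hy := haff y ⟨hax.trans hxy, hyc⟩
      linarith
    · linarith [key y hcy hyb]
  · exact hf.sub_le_mul_sub_of_left ⟨hac.le, hcb⟩ ⟨hax.trans hxy, hyb⟩ hcx hxy
      (key x hcx.le (hxy.trans hyb))

/-- The slope of a final affine piece bounds all slopes of a concave function from below. -/
theorem ConcaveOn.le_sub_of_affine_right {a b d s : ℝ} {f : ℝ → ℝ}
    (hf : ConcaveOn ℝ (Set.Icc a b) f) (had : a ≤ d) (hdb : d < b)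
    (haff : ∀ x ∈ Set.Icc d b, f x = f d + s * (x - d))
    {x y : ℝ} (hax : a ≤ x) (hxy : x ≤ y) (hyb : y ≤ b) : s * (y - x) ≤ f y - f x := by
  have hb := haff b ⟨hdb.le, le_rfl⟩
  have key : ∀ z, a ≤ z → z ≤ d → s * (d - z) ≤ f d - f z := fun z haz hzd =>
    hf.mul_sub_le_sub_of_right ⟨haz, hzd.trans hdb.le⟩ ⟨had.trans hdb.le, le_rfl⟩ hzd hdb
      (by linarith)
  rcases le_or_gt d y with hdy | hyd
  · have hy := haff y ⟨hdy, hyb⟩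
    rcases le_total d x with hdx | hxd
    · have hx := haff x ⟨hdx, hxy.trans hyb⟩
      linarith
    · linarith [key x hax hxd]
  · exact hf.mul_sub_le_sub_of_right ⟨hax, hxy.trans hyb⟩ ⟨had, hdb.le⟩ hxy hyd
      (key y (hax.trans hxy) hyd.le)

/-- The one-dimensional core of Proposition 3: a concave function on `[a,b]` that is affine
with slope of absolute value at most 1 on the two outermost pieces `[a,c]` and `[d,b]`
is 1-Lipschitz on all of `[a,b]`. -/
theorem concave_affine_outer_pieces_one_lipschitz
    (a b c d : ℝ) (hac : a < c) (hcd : c ≤ d) (hdb : d < b)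
    (f : ℝ → ℝ) (hconc : ConcaveOn ℝ (Set.Icc a b) f)
    (s₁ s₂ : ℝ) (hs₁ : |s₁| ≤ 1) (hs₂ : |s₂| ≤ 1)
    (haff₁ : ∀ x ∈ Set.Icc a c, f x = f a + s₁ * (x - a))
    (haff₂ : ∀ x ∈ Set.Icc d b, f x = f d + s₂ * (x - d)) :
    ∀ x ∈ Set.Icc a b, ∀ y ∈ Set.Icc a b, |f x - f y| ≤ |x - y| := by
  have key : ∀ x y, a ≤ x → x ≤ y → y ≤ b → |f x - f y| ≤ |x - y| := by
    intro x y hax hxy hyb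
    have upper := hconc.sub_le_of_affine_left hac (hcd.trans hdb.le) haff₁ hax hxy hyb
    have lower := hconc.le_sub_of_affine_right (hac.le.trans hcd) hdb haff₂ hax hxy hyb
    have h₁ := mul_le_mul_of_nonneg_right (abs_le.1 hs₁).2 (sub_nonneg.2 hxy)
    have h₂ := mul_le_mul_of_nonneg_right (abs_le.1 hs₂).1 (sub_nonneg.2 hxy)
    rw [abs_sub_comm, abs_sub_comm x, abs_of_nonneg (sub_nonneg.2 hxy), abs_le]
    constructor <;> linarith
  intro x hx y hy
  rcases le_total x y with h | h
  · exact key x y hx.1 h hy.2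
  · rw [abs_sub_comm, abs_sub_comm x]
    exact key y x hy.1 h hx.2
end
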